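/- If Ω is any proper subdomain of ℂ and Y is a Hurwitz non-Lipschitz subdomain of the unit disk 𝔻 (i.e. l_η(Y,𝔻) = 1), then η_Ω^Y(w) = η_Ω(w) for every w ∈ Ω. -/

import Mathlib

open Complex Set Metric
open scoped ENNReal

noncomputable section

/-- The open unit disk in the complex plane. -/
def unitDisk : Set ℂ := Metric.ball (0 : ℂ) 1

/-- A plane domain: a nonempty open connected subset of ℂ. -/
def IsPlaneDomain (S : Set ℂ) : Prop := IsOpen S ∧ IsConnected S

/-- The Hurwitz radius `r_Ω(w)`: the supremum of `h'(0)` over all holomorphic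
`h : 𝔻 → Ω` with `h 0 = w`, `h t ≠ w` for `t ∈ 𝔻 \ {0}`, and `h'(0) > 0` (real). -/
def hurwitzRadius (Ω : Set ℂ) (w : ℂ) : ℝ :=
  sSup { r : ℝ | 0 < r ∧ ∃ h : ℂ → ℂ, DifferentiableOn ℂ h unitDisk ∧
    Set.MapsTo h unitDisk Ω ∧ h 0 = w ∧ (∀ t ∈ unitDisk, t ≠ 0 → h t ≠ w) ∧
    deriv h 0 = (r : ℂ) }

/-- The Hurwitz density `η_Ω(w) = 2 / r_Ω(w)`. -/
def hurwitzDensity (Ω : Set ℂ) (w : ℂ) : ℝ := 2 / hurwitzRadius Ω w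

/-- A (C¹, hence rectifiable) path in `Ω` from `w₁` to `w₂`, parametrized on `[0,1]`. -/
def IsPathIn (Ω : Set ℂ) (w₁ w₂ : ℂ) (γ : ℝ → ℂ) : Prop :=
  γ 0 = w₁ ∧ γ 1 = w₂ ∧ (∀ t ∈ Set.Icc (0:ℝ) 1, γ t ∈ Ω) ∧
    ContDiffOn ℝ 1 γ (Set.Icc (0:ℝ) 1)

/-- The Hurwitz distance: infimum of Hurwitz lengths of rectifiable paths in `Ω`. -/
def hurwitzDist (Ω : Set ℂ) (w₁ w₂ : ℂ) : ℝ :=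
  sInf { L : ℝ | ∃ γ : ℝ → ℂ, IsPathIn Ω w₁ w₂ γ ∧
    L = ∫ t in (0:ℝ)..1, hurwitzDensity Ω (γ t) * ‖derivWithin γ (Set.Icc (0:ℝ) 1) t‖ }

/-- The generalized Hurwitz density `η_Ω^Y(w)` with basepoint domain `Y`
(`+∞` if no admissible map exists). -/
def genHurwitzDensity (Y Ω : Set ℂ) (w : ℂ) : ℝ≥0∞ :=
  sInf { x : ℝ≥0∞ | ∃ s ∈ Y, ∃ h : ℂ → ℂ, DifferentiableOn ℂ h Y ∧
    Set.MapsTo h Y Ω ∧ h s = w ∧ (∀ t ∈ Y, t ≠ s → h t ≠ w) ∧ deriv h s ≠ 0 ∧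
    x = ENNReal.ofReal (hurwitzDensity Y s / ‖deriv h s‖) }

/-- The generalized Hurwitz distance `η_Ω^Y(z₁,z₂)`. -/
def genHurwitzDist (Y Ω : Set ℂ) (z₁ z₂ : ℂ) : ℝ≥0∞ :=
  sInf { L : ℝ≥0∞ | ∃ γ : ℝ → ℂ, IsPathIn Ω z₁ z₂ γ ∧
    L = ∫⁻ t in Set.Icc (0:ℝ) 1,
      genHurwitzDensity Y Ω (γ t) * ENNReal.ofReal ‖derivWithin γ (Set.Icc (0:ℝ) 1) t‖ }

/-- The infinitesimal contraction constant `l_η(Ω, Y)`. -/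
def lEta (Ω Y : Set ℂ) : ℝ :=
  sSup { x : ℝ | ∃ w ∈ Ω, x = hurwitzDensity Y w / hurwitzDensity Ω w }

/-- The global contraction constant `gl_η(Ω, Y)`. -/
def glEta (Ω Y : Set ℂ) : ℝ :=
  sSup { x : ℝ | ∃ w₁ ∈ Ω, ∃ w₂ ∈ Ω, w₁ ≠ w₂ ∧
    x = hurwitzDist Y w₁ w₂ / hurwitzDist Ω w₁ w₂ }

/-- The set of admissible derivatives whose supremum is `hurwitzRadius Ω w`. -/
def hurwitzDerivs (Ω : Set ℂ) (w : ℂ) : Set ℝ :=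
  { r : ℝ | 0 < r ∧ ∃ h : ℂ → ℂ, DifferentiableOn ℂ h unitDisk ∧
    Set.MapsTo h unitDisk Ω ∧ h 0 = w ∧ (∀ t ∈ unitDisk, t ≠ 0 → h t ≠ w) ∧
    deriv h 0 = (r : ℂ) }

theorem hurwitzRadius_eq_sSup (Ω : Set ℂ) (w : ℂ) :
    hurwitzRadius Ω w = sSup (hurwitzDerivs Ω w) := rfl

theorem isOpen_unitDisk : IsOpen unitDisk := Metric.isOpen_ball

theorem mem_unitDisk {z : ℂ} : z ∈ unitDisk ↔ ‖z‖ < 1 := by simp [unitDisk]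

theorem zero_mem_unitDisk : (0 : ℂ) ∈ unitDisk := by simp [mem_unitDisk]

/-- An admissible map may be rotated so that its derivative becomes positive. -/
theorem norm_mem_hurwitzDerivs {Ω : Set ℂ} {w : ℂ} {h : ℂ → ℂ}
    (hd : DifferentiableOn ℂ h unitDisk) (hm : Set.MapsTo h unitDisk Ω) (h0 : h 0 = w)
    (hne : ∀ t ∈ unitDisk, t ≠ 0 → h t ≠ w) (hder : deriv h 0 ≠ 0) :
    ‖deriv h 0‖ ∈ hurwitzDerivs Ω w := by
  have hpos : 0 < ‖deriv h 0‖ := norm_pos_iff.2 hder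
  set u : ℂ := ‖deriv h 0‖ / deriv h 0 with hu
  have hun : ‖u‖ = 1 := by
    rw [hu, norm_div, norm_real, norm_norm, div_self hpos.ne']
  have hu0 : u ≠ 0 := norm_pos_iff.1 (by rw [hun]; exact one_pos)
  have hmaps : Set.MapsTo (fun t => u * t) unitDisk unitDisk := fun t ht => by
    rw [mem_unitDisk] at ht ⊢
    rwa [norm_mul, hun, one_mul]
  refine ⟨hpos, fun t => h (u * t), ?_, fun t ht => hm (hmaps ht), by simpa using h0,
    fun t ht ht0 => hne _ (hmaps ht) (mul_ne_zero hu0 ht0), ?_⟩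
  · exact hd.comp (by fun_prop) hmaps
  · have h1 : HasDerivAt h (deriv h 0) (u * 0) := by
      rw [mul_zero]
      exact (hd.differentiableAt (isOpen_unitDisk.mem_nhds zero_mem_unitDisk)).hasDerivAt
    have h2 : HasDerivAt (fun t : ℂ => u * t) u 0 := by
      simpa using (hasDerivAt_id (0 : ℂ)).const_mul u
    have h3 : HasDerivAt (fun t => h (u * t)) (deriv h 0 * u) 0 := h1.comp 0 h2
    rw [h3.deriv, hu]
    field_simp

theorem hurwitzDerivs_nonempty {Ω : Set ℂ} (hΩ : IsOpen Ω) {w : ℂ} (hw : w ∈ Ω) :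
    (hurwitzDerivs Ω w).Nonempty := by
  obtain ⟨ε, hε, hball⟩ := Metric.isOpen_iff.1 hΩ w hw
  refine ⟨ε, hε, fun t => w + ε * t, by fun_prop, fun t ht => hball ?_, by simp, ?_, ?_⟩
  · rw [mem_unitDisk] at ht
    simpa [abs_of_pos hε] using mul_lt_mul_of_pos_left ht hε
  · intro t _ ht0
    simp [ht0, hε.ne']
  · have : HasDerivAt (fun t : ℂ => w + ε * t) (ε * 1) 0 :=
      ((hasDerivAt_id (0 : ℂ)).const_mul (ε : ℂ)).const_add w
    rw [this.deriv, mul_one]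

/-- This also holds when the admissible derivatives are unbounded, both the density and
the infimum of `2 / r` being zero then. -/
theorem hurwitzDensity_le {Ω : Set ℂ} {w : ℂ} {r : ℝ} (hr : r ∈ hurwitzDerivs Ω w) :
    hurwitzDensity Ω w ≤ 2 / r := by
  have hr0 : 0 < r := hr.1
  rw [hurwitzDensity, hurwitzRadius_eq_sSup]
  by_cases hb : BddAbove (hurwitzDerivs Ω w)
  · have := le_csSup hb hr
    gcongr
  · rw [Real.sSup_of_not_bddAbove hb]
    simpa using div_nonneg zero_le_two hr0.le

theorem hurwitzDensity_nonneg (Ω : Set ℂ) (w : ℂ) : 0 ≤ hurwitzDensity Ω w :=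
  div_nonneg zero_le_two (Real.sSup_nonneg fun _ hr => hr.1.le)

theorem exists_two_div_lt {Ω : Set ℂ} (hΩ : IsOpen Ω) {w : ℂ} (hw : w ∈ Ω) {x : ℝ}
    (hx : hurwitzDensity Ω w < x) : ∃ r ∈ hurwitzDerivs Ω w, 2 / r < x := by
  have hx0 : 0 < x := (hurwitzDensity_nonneg Ω w).trans_lt hx
  have hne := hurwitzDerivs_nonempty hΩ hw
  suffices ∃ r ∈ hurwitzDerivs Ω w, 2 / x < r by
    obtain ⟨r, hr, hlt⟩ := this
    exact ⟨r, hr, (div_lt_comm₀ hx0 hr.1).1 hlt⟩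
  by_cases hb : BddAbove (hurwitzDerivs Ω w)
  · apply exists_lt_of_lt_csSup hne
    rw [hurwitzDensity, hurwitzRadius_eq_sSup] at hx
    obtain ⟨r, hr⟩ := hne
    have hs : 0 < sSup (hurwitzDerivs Ω w) := hr.1.trans_le (le_csSup hb hr)
    exact (div_lt_comm₀ hs hx0).1 hx
  · rw [bddAbove_def] at hb
    push Not at hb
    exact hb _

theorem bddAbove_hurwitzDerivs {Y : Set ℂ} (hsub : Y ⊆ unitDisk) (w : ℂ) :
    BddAbove (hurwitzDerivs Y w) := by
  refine ⟨2, ?_⟩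
  rintro r ⟨hr, h, hd, hm, h0, -, hder⟩
  have hw : ‖w‖ < 1 := by
    rw [← h0]
    exact mem_unitDisk.1 (hsub (hm zero_mem_unitDisk))
  have key : ‖deriv h 0‖ ≤ 2 / 1 := by
    refine norm_deriv_le_div_of_mapsTo_ball hd (fun t ht => ?_) one_pos
    have := mem_unitDisk.1 (hsub (hm ht))
    rw [h0, mem_closedBall, dist_eq_norm]
    linarith [norm_sub_le (h t) w]
  rw [hder, norm_real, Real.norm_of_nonneg hr.le] at key
  linarith

theorem hurwitzDensity_pos_of_subset_unitDisk {Y : Set ℂ} (hY : IsOpen Y) (hsub : Y ⊆ unitDisk)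
    {s : ℂ} (hs : s ∈ Y) : 0 < hurwitzDensity Y s := by
  obtain ⟨r, hr⟩ := hurwitzDerivs_nonempty hY hs
  have : 0 < sSup (hurwitzDerivs Y s) :=
    hr.1.trans_le (le_csSup (bddAbove_hurwitzDerivs hsub s) hr)
  exact div_pos two_pos this

/-- Holomorphic maps taking the value `h s` only at `s` contract the Hurwitz density. -/
theorem hurwitzDensity_le_div_norm_deriv {Y Ω : Set ℂ} (hY : IsOpen Y) {s : ℂ} (hs : s ∈ Y)
    {h : ℂ → ℂ} (hd : DifferentiableOn ℂ h Y) (hm : Set.MapsTo h Y Ω)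
    (hne : ∀ t ∈ Y, t ≠ s → h t ≠ h s) (hder : deriv h s ≠ 0) :
    hurwitzDensity Ω (h s) ≤ hurwitzDensity Y s / ‖deriv h s‖ := by
  have hn : 0 < ‖deriv h s‖ := norm_pos_iff.2 hder
  rw [le_div_iff₀ hn]
  refine le_of_forall_gt fun x hx => ?_
  obtain ⟨r, ⟨hr, g, hgd, hgm, hg0, hgne, hgder⟩, hlt⟩ := exists_two_div_lt hY hs hx
  have hmem : r * ‖deriv h s‖ ∈ hurwitzDerivs Ω (h s) := by
    have h1 : HasDerivAt h (deriv h s) (g 0) := by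
      rw [hg0]
      exact (hd.differentiableAt (hY.mem_nhds hs)).hasDerivAt
    have h2 : HasDerivAt g r 0 := by
      rw [← hgder]
      exact (hgd.differentiableAt (isOpen_unitDisk.mem_nhds zero_mem_unitDisk)).hasDerivAt
    have h3 : deriv (h ∘ g) 0 = deriv h s * r := (h1.comp 0 h2).deriv
    have h4 := norm_mem_hurwitzDerivs (w := h s) (hd.comp hgd hgm) (hm.comp hgm) (by simp [hg0])
      (fun t ht ht0 => hne _ (hgm ht) (hgne t ht ht0))
      (by rw [h3]; exact mul_ne_zero hder (ofReal_ne_zero.2 hr.ne'))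
    rwa [h3, norm_mul, norm_real, Real.norm_of_nonneg hr.le, mul_comm] at h4
  calc hurwitzDensity Ω (h s) * ‖deriv h s‖
      ≤ 2 / (r * ‖deriv h s‖) * ‖deriv h s‖ := by gcongr; exact hurwitzDensity_le hmem
    _ = 2 / r := by field_simp
    _ < x := hlt

/-- The automorphism of the unit disk sending `0` to `a` and `-a` to `0`. -/
def diskAut (a z : ℂ) : ℂ := (z + a) / (1 + (starRingEnd ℂ) a * z)

theorem one_add_conj_mul_ne_zero {a z : ℂ} (ha : a ∈ unitDisk) (hz : z ∈ unitDisk) :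
    1 + (starRingEnd ℂ) a * z ≠ 0 := by
  rw [mem_unitDisk] at ha hz
  intro h
  have h1 : ‖(starRingEnd ℂ) a * z‖ = 1 := by
    rw [← eq_neg_of_add_eq_zero_right h |>.symm, norm_neg, norm_one]
  rw [norm_mul, RCLike.norm_conj] at h1
  nlinarith [norm_nonneg a, norm_nonneg z]

theorem one_sub_norm_sq_pos {a : ℂ} (ha : a ∈ unitDisk) : 0 < 1 - ‖a‖ ^ 2 := by
  rw [mem_unitDisk] at ha
  nlinarith [norm_nonneg a]

theorem diskAut_mapsTo {a : ℂ} (ha : a ∈ unitDisk) :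
    Set.MapsTo (diskAut a) unitDisk unitDisk := by
  intro z hz
  have hden := norm_pos_iff.2 (one_add_conj_mul_ne_zero ha hz)
  have h1 := mul_pos (one_sub_norm_sq_pos ha) (one_sub_norm_sq_pos hz)
  rw [mem_unitDisk, diskAut, norm_div, div_lt_one hden]
  refine lt_of_pow_lt_pow_left₀ 2 hden.le ?_
  rw [Complex.sq_norm, Complex.sq_norm, normSq_apply, normSq_apply] at h1 ⊢
  simp only [add_re, add_im, mul_re, mul_im, conj_re, conj_im, one_re, one_im]
  nlinarith

theorem hasDerivAt_diskAut {a z : ℂ} (ha : a ∈ unitDisk) (hz : z ∈ unitDisk) :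
    HasDerivAt (diskAut a) ((1 - ‖a‖ ^ 2 : ℝ) / (1 + (starRingEnd ℂ) a * z) ^ 2) z := by
  have h := ((hasDerivAt_id z).add_const a).div
    (((hasDerivAt_id z).const_mul ((starRingEnd ℂ) a)).const_add 1)
    (one_add_conj_mul_ne_zero ha hz)
  refine h.congr_deriv ?_
  congr 1
  rw [Complex.sq_norm, ofReal_sub, normSq_eq_conj_mul_self, ofReal_one, id]
  ring

theorem differentiableOn_diskAut {a : ℂ} (ha : a ∈ unitDisk) :
    DifferentiableOn ℂ (diskAut a) unitDisk := fun _ hz =>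
  (hasDerivAt_diskAut ha hz).differentiableAt.differentiableWithinAt

theorem diskAut_zero (a : ℂ) : diskAut a 0 = a := by simp [diskAut]

theorem diskAut_ne {a z : ℂ} (ha : a ∈ unitDisk) (hz : z ∈ unitDisk) (hz0 : z ≠ 0) :
    diskAut a z ≠ a := by
  intro h
  rw [diskAut, div_eq_iff (one_add_conj_mul_ne_zero ha hz)] at h
  have h1 : ((1 - ‖a‖ ^ 2 : ℝ) : ℂ) * z = 0 := by
    rw [Complex.sq_norm, ofReal_sub, normSq_eq_conj_mul_self, ofReal_one]
    linear_combination h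
  exact mul_ne_zero (ofReal_ne_zero.2 (one_sub_norm_sq_pos ha).ne') hz0 h1

theorem hurwitzDensity_unitDisk_le {s : ℂ} (hs : s ∈ unitDisk) :
    hurwitzDensity unitDisk s ≤ 2 / (1 - ‖s‖ ^ 2) :=
  hurwitzDensity_le ⟨one_sub_norm_sq_pos hs, diskAut s, differentiableOn_diskAut hs,
    diskAut_mapsTo hs, diskAut_zero s, fun _ ht ht0 => diskAut_ne hs ht ht0, by
      simpa using (hasDerivAt_diskAut hs zero_mem_unitDisk).deriv⟩

/-- Precomposing an admissible map on the disk with a disk automorphism bounds the generalized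
density from above. -/
theorem genHurwitzDensity_le {Y Ω : Set ℂ} (hsub : Y ⊆ unitDisk) {s w : ℂ}
    (hs : s ∈ Y) {r : ℝ} (hr : r ∈ hurwitzDerivs Ω w) :
    genHurwitzDensity Y Ω w ≤
      ENNReal.ofReal (hurwitzDensity Y s * (1 - ‖s‖ ^ 2) / r) := by
  obtain ⟨hr0, h, hd, hm, h0, hne, hder⟩ := hr
  have hsD := hsub hs
  have hpos := one_sub_norm_sq_pos hsD
  have hs' : -s ∈ unitDisk := by simpa [mem_unitDisk] using hsD
  have hzero : diskAut (-s) s = 0 := by simp [diskAut]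
  have hmaps : Set.MapsTo (diskAut (-s)) Y unitDisk := (diskAut_mapsTo hs').mono_left hsub
  have hφ : HasDerivAt (diskAut (-s)) ((1 - ‖s‖ ^ 2 : ℝ)⁻¹ : ℂ) s := by
    convert hasDerivAt_diskAut hs' hsD using 1
    have : 1 + (starRingEnd ℂ) (-s) * s = ((1 - ‖s‖ ^ 2 : ℝ) : ℂ) := by
      rw [Complex.sq_norm, ofReal_sub, normSq_eq_conj_mul_self, ofReal_one, map_neg]
      ring
    have hc : ((1 - ‖s‖ ^ 2 : ℝ) : ℂ) ≠ 0 := ofReal_ne_zero.2 hpos.ne'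
    rw [this, norm_neg]
    field_simp
  have hh : HasDerivAt h r (diskAut (-s) s) := by
    rw [hzero, ← hder]
    exact (hd.differentiableAt (isOpen_unitDisk.mem_nhds zero_mem_unitDisk)).hasDerivAt
  have hcomp : deriv (h ∘ diskAut (-s)) s = r * ((1 - ‖s‖ ^ 2 : ℝ) : ℂ)⁻¹ := (hh.comp s hφ).deriv
  have hval : deriv (h ∘ diskAut (-s)) s = ((r / (1 - ‖s‖ ^ 2) : ℝ) : ℂ) := by
    rw [hcomp, ofReal_div, div_eq_mul_inv]
  have hq : 0 < r / (1 - ‖s‖ ^ 2) := div_pos hr0 hpos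
  refine sInf_le ⟨s, hs, h ∘ diskAut (-s),
    hd.comp ((differentiableOn_diskAut hs').mono hsub) hmaps, hm.comp hmaps, by simp [hzero, h0],
    fun t ht hts => hne _ (hmaps ht) ?_, ?_, ?_⟩
  · rw [diskAut]
    exact div_ne_zero (by rwa [← sub_eq_add_neg, sub_ne_zero])
      (one_add_conj_mul_ne_zero hs' (hsub ht))
  · rw [hval]
    exact ofReal_ne_zero.2 hq.ne'
  · rw [hval, norm_real, Real.norm_of_nonneg hq.le, div_div_eq_mul_div]

/-- if `Y` is a Hurwitz non-Lipschitz subdomain of the unit disk,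
then the generalized and ordinary Hurwitz densities coincide on any proper
subdomain `Ω` of `ℂ`. -/
theorem genHurwitz_eq_hurwitz_of_nonLipschitz_in_disk
    (Ω Y : Set ℂ) (hΩ : IsPlaneDomain Ω) (hΩp : Ω ≠ Set.univ)
    (hY : IsPlaneDomain Y) (hsub : Y ⊆ unitDisk) (hnl : lEta Y unitDisk = 1) :
    ∀ w ∈ Ω, genHurwitzDensity Y Ω w = ENNReal.ofReal (hurwitzDensity Ω w) := by
  intro w hw
  have hYo : IsOpen Y := hY.1
  apply le_antisymm
  · suffices H : ∀ x, hurwitzDensity Ω w < x → genHurwitzDensity Y Ω w ≤ ENNReal.ofReal x by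
      refine ENNReal.le_of_forall_pos_le_add fun ε hε _ => ?_
      have h1 := H (hurwitzDensity Ω w + ε) (lt_add_of_pos_right _ hε)
      rwa [ENNReal.ofReal_add (hurwitzDensity_nonneg Ω w) ε.coe_nonneg,
        ENNReal.ofReal_coe_nnreal] at h1
    intro x hx
    obtain ⟨r, hr, hlt⟩ := exists_two_div_lt hΩ.1 hw hx
    have hr0 : 0 < r := hr.1
    have hx0 : 0 < x := (hurwitzDensity_nonneg Ω w).trans_lt hx
    have hc : 2 / r / x < lEta Y unitDisk := by
      rw [hnl]
      exact (div_lt_one hx0).2 hlt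
    obtain ⟨s₀, hs₀⟩ := hY.2.nonempty
    obtain ⟨_, ⟨s, hs, rfl⟩, hs_lt⟩ :=
      exists_lt_of_lt_csSup (by exact ⟨_, s₀, hs₀, rfl⟩) hc
    have hpos := one_sub_norm_sq_pos (hsub hs)
    have hηY := hurwitzDensity_pos_of_subset_unitDisk hYo hsub hs
    refine (genHurwitzDensity_le hsub hs hr).trans (ENNReal.ofReal_le_ofReal ?_)
    rw [lt_div_iff₀ hηY] at hs_lt
    have h1 := hs_lt.le.trans (hurwitzDensity_unitDisk_le (hsub hs))
    rw [le_div_iff₀ hpos] at h1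
    calc hurwitzDensity Y s * (1 - ‖s‖ ^ 2) / r
        = 2 / r / x * hurwitzDensity Y s * (1 - ‖s‖ ^ 2) * (x / 2) := by field_simp
      _ ≤ 2 * (x / 2) := by gcongr
      _ = x := by ring
  · refine le_sInf ?_
    rintro _ ⟨s, hs, h, hd, hm, rfl, hne, hder, rfl⟩
    exact ENNReal.ofReal_le_ofReal
      (hurwitzDensity_le_div_norm_deriv hYo hs hd hm hne hder)
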